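/- Let w ∈ 𝒮_n be a sequence that is NOT a permutation of (1, 2, …, n), i.e. w ∈ 𝒯_n = 𝒮_n \ {π(1,…,n) : π ∈ S_n}. Then the homology of ⟦w⟧ consists entirely of torsion: H_k(⟦w⟧ ⊗ ℚ) = 0 for all k, equivalently every homology group H_k⟦w⟧ (with ℤ coefficients) is a torsion abelian group. -/

import Mathlib

namespace Nil

/-- Index pairs `(a,b)` with `a < b` in `Fin n`, indexing the basis `e_{ab}` of `nil_n`. -/
abbrev P (n : ℕ) : Type := {p : Fin n × Fin n // p.1 < p.2}

/-- Lexicographic key of a pair. -/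
def key {n : ℕ} (p : P n) : ℕ := p.1.1.1 * n + p.1.2.1

/-- Position (0-based) of `a` in the lexicographically sorted list of `M`. -/
def pos {n : ℕ} (M : Finset (P n)) (a : P n) : ℕ :=
  (M.filter fun b => key b < key a).card

/-- Basis of the degree `k` part of the Chevalley-Eilenberg complex `Λ^* nil_n`:
subsets `M` of pairs with `|M| = k` (empty for `k < 0`). -/
abbrev B (n : ℕ) (k : ℤ) : Type := {M : Finset (P n) // (M.card : ℤ) = k}

/-- Degree `k` chain group of the Chevalley-Eilenberg complex of `nil_n`. -/
abbrev C (n : ℕ) (k : ℤ) : Type := B n k →₀ ℤ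

/-- The Chevalley-Eilenberg boundary of a basis wedge `e_M`:
`∂(e_{a₁b₁} ∧ … ∧ e_{aₖbₖ}) = Σ_{i<j} (-1)^{i+j} [e_{aᵢbᵢ}, e_{aⱼbⱼ}] ∧ …` (omitting
the i-th and j-th factors), written in the lexicographically sorted basis.
For lexicographically sorted wedges the only nonzero brackets come from pairs
`a = (x,y)`, `b = (y,z)`, producing `±e_{(x,z)}`. -/
noncomputable def dAux {n : ℕ} (k : ℤ) (M : Finset (P n)) : C n k :=
  ∑ a ∈ M, ∑ b ∈ M,
    if hab : a.1.2 = b.1.1 then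
      (let c : P n := ⟨(a.1.1, b.1.2), lt_trans a.2 (by rw [hab]; exact b.2)⟩
       let M' : Finset (P n) := insert c ((M.erase a).erase b)
       if h' : (M'.card : ℤ) = k then
         ((-1 : ℤ) ^ (pos M a + pos M b + pos M' c)) • Finsupp.single (⟨M', h'⟩ : B n k) 1
       else 0)
    else 0

/-- The Chevalley-Eilenberg boundary map in degree `k+1`. -/
noncomputable def d (n : ℕ) (k : ℤ) : C n (k + 1) →ₗ[ℤ] C n k :=
  Finsupp.lsum ℤ fun M => LinearMap.toSpanSingleton ℤ (C n k) (dAux k M.1)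

/-- Degree-cast isomorphism. -/
noncomputable def castC (n : ℕ) {k l : ℤ} (h : k = l) : C n k ≃ₗ[ℤ] C n l :=
  Finsupp.domLCongr (Equiv.subtypeEquivRight fun _ => by rw [h])

/-- The boundary map out of degree `k`. -/
noncomputable def dFrom (n : ℕ) (k : ℤ) : C n k →ₗ[ℤ] C n (k - 1) :=
  (d n (k - 1)).comp (castC n (by ring : k = k - 1 + 1)).toLinearMap

/-- Cycles of `Λ^* nil_n` in degree `k`. -/
noncomputable def Zfull (n : ℕ) (k : ℤ) : Submodule ℤ (C n k) := LinearMap.ker (dFrom n k)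

noncomputable def HnilSub (n : ℕ) (k : ℤ) : Submodule ℤ (Zfull n k) :=
  Submodule.comap (Zfull n k).subtype (LinearMap.range (d n k) ⊓ Zfull n k)

/-- `H_k(nil_n; ℤ)`: the `k`-th integral homology of the Chevalley-Eilenberg complex
of the Lie ring of strictly upper triangular `n × n` integer matrices. -/
noncomputable def Hnil (n : ℕ) (k : ℤ) : Type := Zfull n k ⧸ HnilSub n k

noncomputable instance (n : ℕ) (k : ℤ) : AddCommGroup (Hnil n k) :=
  inferInstanceAs (AddCommGroup (Zfull n k ⧸ HnilSub n k))

noncomputable instance (n : ℕ) (k : ℤ) : Module ℤ (Hnil n k) :=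
  inferInstanceAs (Module ℤ (Zfull n k ⧸ HnilSub n k))

/-- The modified weight of a basis wedge `e_M` (indices of `Fin n` are 0-based, so the
`i`-th weight of the paper, `1 ≤ i ≤ n`, is `wt M ⟨i-1,_⟩`):
`w_i(e_M) = i - #{x : (x,i) ∈ M} + #{y : (i,y) ∈ M}`. -/
def wt {n : ℕ} (M : Finset (P n)) : Fin n → ℤ := fun i =>
  ((i.1 : ℤ) + 1) - (M.filter fun p => p.1.2 = i).card + (M.filter fun p => p.1.1 = i).card

/-- Basis wedges of degree `k` and modified weight `w`. -/
abbrev Bw (n : ℕ) (k : ℤ) (w : Fin n → ℤ) : Type :=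
  {M : Finset (P n) // (M.card : ℤ) = k ∧ wt M = w}

/-- Degree `k` part of the weight summand `⟦w⟧` of `Λ^* nil_n`. -/
abbrev Cw (n : ℕ) (k : ℤ) (w : Fin n → ℤ) : Type := Bw n k w →₀ ℤ

/-- Inclusion of the weight summand. -/
noncomputable def inclW (n : ℕ) (k : ℤ) (w : Fin n → ℤ) : Cw n k w →ₗ[ℤ] C n k :=
  Finsupp.lmapDomain ℤ ℤ fun M => (⟨M.1, M.2.1⟩ : B n k)

/-- Projection onto the weight summand. -/
noncomputable def projW (n : ℕ) (k : ℤ) (w : Fin n → ℤ) : C n k →ₗ[ℤ] Cw n k w :=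
  Finsupp.lsum ℤ fun M =>
    if h : wt M.1 = w then
      LinearMap.toSpanSingleton ℤ (Cw n k w) (Finsupp.single (⟨M.1, M.2, h⟩ : Bw n k w) 1)
    else 0

/-- The boundary of the weight summand `⟦w⟧` (the boundary preserves weights, so this
is the restriction of the Chevalley-Eilenberg boundary). -/
noncomputable def dW (n : ℕ) (k : ℤ) (w : Fin n → ℤ) : Cw n (k + 1) w →ₗ[ℤ] Cw n k w :=
  (projW n k w) ∘ₗ (d n k) ∘ₗ (inclW n (k + 1) w)

noncomputable def castCw (n : ℕ) (w : Fin n → ℤ) {k l : ℤ} (h : k = l) :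
    Cw n k w ≃ₗ[ℤ] Cw n l w :=
  Finsupp.domLCongr (Equiv.subtypeEquivRight fun _ => by rw [h])

noncomputable def dFromW (n : ℕ) (k : ℤ) (w : Fin n → ℤ) : Cw n k w →ₗ[ℤ] Cw n (k - 1) w :=
  (dW n (k - 1) w).comp (castCw n w (by ring : k = k - 1 + 1)).toLinearMap

noncomputable def ZW (n : ℕ) (k : ℤ) (w : Fin n → ℤ) : Submodule ℤ (Cw n k w) :=
  LinearMap.ker (dFromW n k w)

noncomputable def HwSub (n : ℕ) (k : ℤ) (w : Fin n → ℤ) : Submodule ℤ (ZW n k w) :=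
  Submodule.comap (ZW n k w).subtype (LinearMap.range (dW n k w) ⊓ ZW n k w)

/-- `H_k⟦w⟧`: the `k`-th homology of the weight summand `⟦w⟧` of `Λ^* nil_n`. -/
noncomputable def Hw (n : ℕ) (k : ℤ) (w : Fin n → ℤ) : Type := ZW n k w ⧸ HwSub n k w

noncomputable instance (n : ℕ) (k : ℤ) (w : Fin n → ℤ) : AddCommGroup (Hw n k w) :=
  inferInstanceAs (AddCommGroup (ZW n k w ⧸ HwSub n k w))

noncomputable instance (n : ℕ) (k : ℤ) (w : Fin n → ℤ) : Module ℤ (Hw n k w) :=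
  inferInstanceAs (Module ℤ (ZW n k w ⧸ HwSub n k w))

/-- `w ∈ 𝒮_n`: all entries lie in `{1,…,n}` and they add up to `binom (n+1) 2`. -/
def Sn (n : ℕ) (w : Fin n → ℤ) : Prop :=
  (∀ i, 1 ≤ w i ∧ w i ≤ (n : ℤ)) ∧ 2 * ∑ i, w i = (n : ℤ) * ((n : ℤ) + 1)

/-- Number of inversions of a permutation of `Fin n`. -/
def invCount (n : ℕ) (π : Equiv.Perm (Fin n)) : ℕ :=
  (Finset.univ.filter fun p : Fin n × Fin n => p.1 < p.2 ∧ π p.2 < π p.1).card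

/-- The weight sequence `(π(1), …, π(n))` attached to a permutation (1-based values). -/
def permWt (n : ℕ) (π : Equiv.Perm (Fin n)) : Fin n → ℤ := fun i => ((π i).1 : ℤ) + 1

/-- The set of inversions of a permutation, as a set of index pairs. -/
def invFinset {n : ℕ} (π : Equiv.Perm (Fin n)) : Finset (P n) :=
  Finset.univ.filter fun p => π p.1.2 < π p.1.1

/-- Index reversal `i ↦ n+1-i` (0-based: `i ↦ n-1-i`). -/
def rev {n : ℕ} (i : Fin n) : Fin n := ⟨n - 1 - i.1, by have := i.isLt; omega⟩

section Ring

variable {R : Type*} [Ring R]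

theorem anticomm_cubic {P Q S S' Q' P' : R} {δ₁ δ₂ δ₃ δ₄ δ₅ : ℤ}
    (h₁ : S * S' = δ₁ • 1 - S' * S) (h₂ : Q * S' = δ₂ • 1 - S' * Q)
    (h₃ : S * Q' = δ₃ • 1 - Q' * S) (h₄ : Q * Q' = δ₄ • 1 - Q' * Q)
    (h₅ : P' * P = δ₅ • 1 - P * P')
    (hPS : S' * P = -(P * S')) (hPQ : Q' * P = -(P * Q'))
    (hQP : P' * Q = -(Q * P')) (hSP : P' * S = -(S * P')) :
    P * Q * S * (S' * Q' * P') + S' * Q' * P' * (P * Q * S) =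
      (δ₁ * δ₄ - δ₂ * δ₃) • (P * P') - δ₁ • (P * Q' * Q * P') + δ₂ • (P * Q' * S * P')
        + δ₃ • (P * S' * Q * P') - δ₄ • (P * S' * S * P') + δ₅ • (S' * Q' * Q * S) := by
  have middle : Q * S' * (S * Q') = (δ₂ * δ₃) • 1 - δ₂ • (Q' * S) - δ₃ • (S' * Q)
      + δ₄ • (S' * S) - S' * Q' * Q * S := by
    calc Q * S' * (S * Q') = (δ₂ * δ₃) • 1 - δ₂ • (Q' * S) - δ₃ • (S' * Q)
          + S' * (Q * Q') * S := by
          rw [h₂, h₃, mul_comm δ₂]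
          simp only [mul_sub, sub_mul, smul_mul_assoc, mul_smul_comm, one_mul, mul_one, mul_assoc,
            smul_sub, smul_smul]
          abel
      _ = _ := by
          rw [h₄]
          simp only [mul_sub, sub_mul, smul_mul_assoc, mul_smul_comm, mul_one, mul_assoc]
          abel
  have left : P * Q * S * (S' * Q' * P') =
      (δ₁ * δ₄ - δ₂ * δ₃) • (P * P') - δ₁ • (P * Q' * Q * P') + δ₂ • (P * Q' * S * P')
        + δ₃ • (P * S' * Q * P') - δ₄ • (P * S' * S * P') + P * S' * Q' * Q * S * P' := by
    calc P * Q * S * (S' * Q' * P') = P * Q * (S * S') * Q' * P' := by noncomm_ring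
      _ = δ₁ • (P * (Q * Q') * P') - P * (Q * S' * (S * Q')) * P' := by
        rw [h₁]
        simp only [mul_sub, sub_mul, smul_mul_assoc, mul_smul_comm, mul_one, mul_assoc]
      _ = _ := by
        rw [middle, h₄]
        simp only [mul_sub, sub_mul, mul_add, add_mul, smul_mul_assoc, mul_smul_comm, mul_one,
          mul_assoc, smul_sub, smul_smul, sub_smul]
        abel
  have right : S' * Q' * P' * (P * Q * S) =
      δ₅ • (S' * Q' * Q * S) - P * S' * Q' * Q * S * P' := by
    calc S' * Q' * P' * (P * Q * S) = S' * Q' * (P' * P) * Q * S := by noncomm_ring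
      _ = δ₅ • (S' * Q' * Q * S) - S' * (Q' * P) * (P' * Q) * S := by
        rw [h₅]
        simp only [mul_sub, sub_mul, smul_mul_assoc, mul_smul_comm, mul_one, mul_assoc]
      _ = δ₅ • (S' * Q' * Q * S) - (S' * P) * Q' * Q * (P' * S) := by
        rw [hPQ, hQP]; noncomm_ring
      _ = _ := by rw [hPS, hSP]; noncomm_ring
  rw [left, right]; abel

theorem sum_mul_sum_add_swap {ι κ : Type*} [Fintype ι] [Fintype κ] (f : ι → R) (g : κ → R) :
    (∑ i, f i) * (∑ j, g j) + (∑ j, g j) * (∑ i, f i) = ∑ i, ∑ j, (f i * g j + g j * f i) := by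
  simp only [Finset.sum_mul_sum, Finset.sum_add_distrib]
  rw [Finset.sum_comm (f := fun j i => g j * f i)]

theorem sum_swap_ends₃ {α M : Type*} [Fintype α] [AddCommMonoid M] (F : α → α → α → M) :
    ∑ x, ∑ y, ∑ z, F x y z = ∑ z, ∑ y, ∑ x, F x y z := by
  rw [Finset.sum_comm]
  simp_rw [Finset.sum_comm (f := fun x z => F x _ z)]
  rw [Finset.sum_comm]

theorem sum_swap_ends₄ {α M : Type*} [Fintype α] [AddCommMonoid M] (F : α → α → α → α → M) :
    ∑ x, ∑ y, ∑ z, ∑ w, F x y z w = ∑ w, ∑ y, ∑ z, ∑ x, F x y z w := by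
  rw [Finset.sum_comm]
  simp_rw [sum_swap_ends₃ (fun x z w => F x _ z w)]
  rw [Finset.sum_comm]

theorem ite_sum_zero {α M : Type*} [Fintype α] [AddCommMonoid M] (p : Prop) [Decidable p]
    (F : α → M) : (if p then ∑ x, F x else 0) = ∑ x, if p then F x else 0 := by
  split_ifs <;> simp

theorem sum_lt_sub_sum_lt {α M : Type*} [Fintype α] [LinearOrder α] [AddCommGroup M]
    (F : α → α → α → α → M) (hF : ∀ x y z w, F w z y x = F x y z w) :
    (∑ x, ∑ y, ∑ z, ∑ w, if x < w then F x y z w else 0)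
        - (∑ x, ∑ y, ∑ z, ∑ w, if y < z then F x y z w else 0) =
      (∑ x, ∑ y, ∑ w, if x < w then F x y y w else 0)
        - ∑ x, ∑ y, ∑ z, if y < z then F x y z x else 0 := by
  have swap : (∑ x, ∑ y, ∑ z, ∑ w, if x < w ∧ z < y then F x y z w else 0) =
      ∑ x, ∑ y, ∑ z, ∑ w, if w < x ∧ y < z then F x y z w else 0 := by
    rw [sum_swap_ends₄]
    refine Finset.sum_congr rfl fun x _ => ?_
    rw [Finset.sum_comm]
    simp only [← hF x]
  have left : (∑ x, ∑ y, ∑ z, ∑ w, if x < w then F x y z w else 0) =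
      (∑ x, ∑ y, ∑ z, ∑ w, if x < w ∧ y < z then F x y z w else 0)
      + (∑ x, ∑ y, ∑ z, ∑ w, if x < w ∧ z < y then F x y z w else 0)
      + ∑ x, ∑ y, ∑ w, if x < w then F x y y w else 0 := by
    have diag : (∑ x, ∑ y, ∑ w, if x < w then F x y y w else 0) =
        ∑ x, ∑ y, ∑ z, ∑ w, if z = y then if x < w then F x y z w else 0 else 0 := by
      simp only [← ite_sum_zero, Finset.sum_ite_eq', Finset.mem_univ, if_true]
    rw [diag]
    simp only [← Finset.sum_add_distrib]
    refine Finset.sum_congr rfl fun x _ => Finset.sum_congr rfl fun y _ =>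
      Finset.sum_congr rfl fun z _ => Finset.sum_congr rfl fun w _ => ?_
    rcases lt_trichotomy y z with h | rfl | h <;> simp [*, not_lt_of_gt, ne_of_lt, ne_of_gt]
  have right : (∑ x, ∑ y, ∑ z, ∑ w, if y < z then F x y z w else 0) =
      (∑ x, ∑ y, ∑ z, ∑ w, if x < w ∧ y < z then F x y z w else 0)
      + (∑ x, ∑ y, ∑ z, ∑ w, if w < x ∧ y < z then F x y z w else 0)
      + ∑ x, ∑ y, ∑ z, if y < z then F x y z x else 0 := by
    have diag : (∑ x, ∑ y, ∑ z, if y < z then F x y z x else 0) =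
        ∑ x, ∑ y, ∑ z, ∑ w, if w = x then if y < z then F x y z w else 0 else 0 := by
      simp only [Finset.sum_ite_eq', Finset.mem_univ, if_true]
    rw [diag]
    simp only [← Finset.sum_add_distrib]
    refine Finset.sum_congr rfl fun x _ => Finset.sum_congr rfl fun y _ =>
      Finset.sum_congr rfl fun z _ => Finset.sum_congr rfl fun w _ => ?_
    rcases lt_trichotomy x w with h | rfl | h <;> simp [*, not_lt_of_gt, ne_of_lt, ne_of_gt]
  rw [left, right, swap]
  abel

theorem sum_eq_sum_diag_add {α M : Type*} [Fintype α] [LinearOrder α] [AddCommMonoid M]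
    (G : α → α → α → α → M) :
    (∑ x, ∑ y, ∑ z, ∑ w, G x y z w) = (∑ x, ∑ y, ∑ z, G x y z y)
      + (∑ x, ∑ y, ∑ z, ∑ w, if y < w then G x y z w else 0)
      + ∑ x, ∑ y, ∑ z, ∑ w, if w < y then G x y z w else 0 := by
  have diag : (∑ x, ∑ y, ∑ z, G x y z y) =
      ∑ x, ∑ y, ∑ z, ∑ w, if w = y then G x y z w else 0 := by
    simp only [Finset.sum_ite_eq', Finset.mem_univ, if_true]
  rw [diag]
  simp only [← Finset.sum_add_distrib]
  refine Finset.sum_congr rfl fun x _ => Finset.sum_congr rfl fun y _ =>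
    Finset.sum_congr rfl fun z _ => Finset.sum_congr rfl fun w _ => ?_
  rcases lt_trichotomy y w with h | rfl | h <;> simp [*, not_lt_of_gt, ne_of_lt, ne_of_gt]

variable {α : Type*} [LinearOrder α] {c a : α → α → R}

/-- Canonical anticommutation relations for families indexed by increasing pairs. -/
structure IsCAR (c a : α → α → R) : Prop where
  cc : ∀ x y z w, c x y * c z w = -(c z w * c x y)
  aa : ∀ x y z w, a x y * a z w = -(a z w * a x y)
  ac : ∀ x y z w,
    a x y * c z w = (if x = z ∧ y = w ∧ x < y then 1 else 0 : ℤ) • 1 - c z w * a x y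
  c_zero : ∀ x y, ¬ x < y → c x y = 0
  a_zero : ∀ x y, ¬ x < y → a x y = 0

namespace IsCAR

theorem cN_comm (h : IsCAR c a) {x y z w : α} (hne : ¬ (x = z ∧ y = w)) :
    c x y * (c z w * a z w) = c z w * a z w * c x y := by
  have h1 : a z w * c x y = - (c x y * a z w) := by
    rw [h.ac, if_neg (fun H => hne ⟨H.1.symm, H.2.1.symm⟩)]; simp
  rw [← mul_assoc, h.cc, mul_assoc (c z w) (a z w), h1]
  noncomm_ring

theorem sandwich (h : IsCAR c a) {x y z w : α} (hne : ¬ (x = z ∧ y = w)) :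
    c x y * c z w * a z w * a x y = c z w * a z w * (c x y * a x y) := by
  rw [mul_assoc (c x y), h.cN_comm hne, mul_assoc]

theorem anticomm (h : IsCAR c a) (x y z x' y' z' : α) :
    c x z * a x y * a y z * (c y' z' * c x' y' * a x' z')
      + c y' z' * c x' y' * a x' z' * (c x z * a x y * a y z) =
    (if y = y' then if z = z' then if y < z then if x = x' then
        if x < y then c x z * a x z else 0 else 0 else 0 else 0 else 0)
      - (if y = y' then if z = z' then if y < z then c x z * c x' y * a x y * a x' z
          else 0 else 0 else 0)
      + (if x = y' then if y = z' then if x < y then c x z * c x' x * a y z * a x' y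
          else 0 else 0 else 0)
      + (if y = x' then if z = y' then if y < z then c x z * c z z' * a x y * a y z'
          else 0 else 0 else 0)
      - (if x = x' then if y = y' then if x < y then c x z * c y z' * a y z * a x z'
          else 0 else 0 else 0)
      + (if x = x' then if z = z' then if x < z then c y' z * c x y' * a x y * a y z
          else 0 else 0 else 0) := by
  by_cases hxz : x < z
  swap
  · simp [h.c_zero x z hxz, hxz]
  rw [anticomm_cubic (h.ac _ _ _ _) (h.ac _ _ _ _) (h.ac _ _ _ _) (h.ac _ _ _ _) (h.ac _ _ _ _)
    (h.cc _ _ _ _) (h.cc _ _ _ _) (h.aa _ _ _ _) (h.aa _ _ _ _)]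
  have double : (if x = y' ∧ y = z' ∧ x < y then 1 else 0 : ℤ)
      * (if y = x' ∧ z = y' ∧ y < z then 1 else 0) = 0 := by
    split_ifs with h₁ h₂ <;> simp
    exact absurd (h₁.1.trans h₂.2.1.symm) hxz.ne
  rw [double, sub_zero]
  congr 1; congr 1; congr 1; congr 1; congr 1
  all_goals
    clear double h
    simp only [ite_and, ite_smul, one_smul, zero_smul, mul_ite, mul_one, mul_zero]
    grind

theorem laplacian [Fintype α] (h : IsCAR c a) :
    (∑ x, ∑ y, ∑ z, c x z * a x y * a y z) * (∑ x, ∑ y, ∑ z, c y z * c x y * a x z)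
      + (∑ x, ∑ y, ∑ z, c y z * c x y * a x z) * (∑ x, ∑ y, ∑ z, c x z * a x y * a y z) =
    ∑ x, ∑ y, ∑ z, if x < y ∧ y < z then
      c x z * a x z + c x y * a x y * (c y z * a y z) - c x z * a x z * (c y z * a y z)
        - c x y * a x y * (c x z * a x z) else 0 := by
  have key := sum_mul_sum_add_swap (fun t : α × α × α => c t.1 t.2.2 * a t.1 t.2.1 * a t.2.1 t.2.2)
    (fun t : α × α × α => c t.2.1 t.2.2 * c t.1 t.2.1 * a t.1 t.2.2)
  simp only [Fintype.sum_prod_type, h.anticomm] at key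
  rw [key]
  simp only [Finset.sum_add_distrib, Finset.sum_sub_distrib, Finset.sum_ite_eq, Finset.mem_univ,
    if_true, Finset.sum_ite_irrel, Finset.sum_const_zero]
  simp only [ite_sum_zero]
  have t₂ : (∑ x, ∑ y, ∑ z, ∑ w, if x < y then c x z * c w x * a y z * a w y else 0) =
      -∑ x, ∑ y, ∑ z, ∑ w, if w < y then c w z * c x w * a x y * a y z else 0 := by
    rw [sum_swap_ends₄]
    simp only [← Finset.sum_neg_distrib]
    refine Finset.sum_congr rfl fun x _ => Finset.sum_congr rfl fun y _ =>
      Finset.sum_congr rfl fun z _ => Finset.sum_congr rfl fun w _ => ?_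
    rw [mul_assoc _ (a y z), h.aa y z]
    split_ifs <;> simp [mul_assoc]
  have t₃ : (∑ x, ∑ y, ∑ z, ∑ w, if y < z then c x z * c z w * a x y * a y w else 0) =
      -∑ x, ∑ y, ∑ z, ∑ w, if y < w then c w z * c x w * a x y * a y z else 0 := by
    simp only [← Finset.sum_neg_distrib]
    refine Finset.sum_congr rfl fun x _ => Finset.sum_congr rfl fun y _ => ?_
    rw [Finset.sum_comm]
    refine Finset.sum_congr rfl fun z _ => Finset.sum_congr rfl fun w _ => ?_
    rw [h.cc x w]
    split_ifs <;> simp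
  have t₄ : (∑ x, ∑ y, ∑ z, ∑ w, if x < y then c x z * c y w * a y z * a x w else 0) =
      -∑ x, ∑ y, ∑ z, ∑ w, if x < w then c x z * c w y * a x y * a w z else 0 := by
    simp only [← Finset.sum_neg_distrib]
    refine Finset.sum_congr rfl fun x _ => ?_
    rw [sum_swap_ends₃]
    refine Finset.sum_congr rfl fun y _ =>
      Finset.sum_congr rfl fun z _ => Finset.sum_congr rfl fun w _ => ?_
    rw [mul_assoc _ (a w z), h.aa w z]
    split_ifs <;> simp [mul_assoc]
  have t₅ : (∑ x, ∑ y, ∑ z, ∑ w, if x < z then c w z * c x w * a x y * a y z else 0) =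
      ∑ x, ∑ y, ∑ z, ∑ w, c w z * c x w * a x y * a y z := by
    refine Finset.sum_congr rfl fun x _ => Finset.sum_congr rfl fun y _ =>
      Finset.sum_congr rfl fun z _ => Finset.sum_congr rfl fun w _ => ?_
    split_ifs with hxz
    · rfl
    · by_cases hxy : x < y
      · rw [h.a_zero y z fun hyz => hxz (hxy.trans hyz), mul_zero]
      · rw [h.a_zero x y hxy, mul_zero, zero_mul]
  have quad := sum_lt_sub_sum_lt (fun x y z w => c x z * c w y * a x y * a w z) fun x y z w => by
    rw [h.cc, mul_assoc, h.aa]; simp only [neg_mul, mul_neg, neg_neg, mul_assoc]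
  rw [t₂, t₃, t₄, t₅, sum_eq_sum_diag_add (fun x y z w => c w z * c x w * a x y * a y z)]
  have collect : ∀ A B C D E F : R, A - B + -C + -D - -E + (F + D + C) = A + F + (E - B) := by
    intros; abel
  have relabel : (∑ x, ∑ y, ∑ w, if x < w then c x y * c w y * a x y * a w y else 0) =
      ∑ x, ∑ y, ∑ z, if x < y then c x z * c y z * a x z * a y z else 0 :=
    Finset.sum_congr rfl fun x _ => Finset.sum_comm
  rw [collect, quad, relabel]
  simp only [← Finset.sum_add_distrib, ← Finset.sum_sub_distrib]
  refine Finset.sum_congr rfl fun x _ => Finset.sum_congr rfl fun y _ =>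
    Finset.sum_congr rfl fun z _ => ?_
  by_cases hxy : x < y
  · by_cases hyz : y < z
    · rw [h.cc x z y z]
      simp only [hxy, hyz, if_true, and_self, neg_mul]
      rw [h.sandwich (fun H => hxy.ne' H.1), h.sandwich (fun H => hxy.ne' H.1),
        h.sandwich (fun H => hyz.ne' H.2)]
      abel
    · simp [hyz, h.a_zero y z hyz]
  · simp [hxy, h.a_zero x y hxy, h.c_zero x y hxy]

end IsCAR
end Ring

section Tournament

variable {α : Type*} [LinearOrder α]

/-- The tournament on `α` in which, for `i < j`, `i` beats `j` exactly when `m i j = 1`. -/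
def beats (m : α → α → ℤ) (i j : α) : ℤ := if i < j then m i j else if j < i then 1 - m j i else 0

theorem beats_self (m : α → α → ℤ) (i : α) : beats m i i = 0 := by simp [beats]

theorem beats_add_beats (m : α → α → ℤ) (i j : α) :
    beats m i j + beats m j i = if i = j then 0 else 1 := by
  unfold beats
  rcases lt_trichotomy i j with h | rfl | h <;> simp [*, not_lt_of_gt, ne_of_lt, ne_of_gt]

theorem beats_eq_zero_or_one {m : α → α → ℤ} (hm : ∀ i j, m i j = 0 ∨ m i j = 1) (i j : α) :
    beats m i j = 0 ∨ beats m i j = 1 := by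
  unfold beats
  have := hm i j
  have := hm j i
  split_ifs <;> omega

theorem sum_cyclic {M : Type*} [AddCommGroup M] [Fintype α] {u : α → α → α → M}
    (hu : ∀ x y z, u y z x = u x y z) (hd : ∀ x z, u x x z = 0) :
    ∑ x, ∑ y, ∑ z, u x y z =
      3 • ∑ x, ∑ y, ∑ z, if x < y ∧ y < z then u x y z + u x z y else 0 := by
  have hd' : ∀ x z, u x z x = 0 := fun x z => by rw [hu, hd]
  have hd'' : ∀ x z, u x z z = 0 := fun x z => by rw [← hu, hd]
  have split : ∀ x y z, u x y z =
      (if x < y ∧ y < z then u x y z else 0) + (if y < z ∧ z < x then u x y z else 0)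
      + (if z < x ∧ x < y then u x y z else 0) + (if x < z ∧ z < y then u x y z else 0)
      + (if z < y ∧ y < x then u x y z else 0) + (if y < x ∧ x < z then u x y z else 0) := by
    intro x y z
    rcases lt_trichotomy x y with h | rfl | h
    · rcases lt_trichotomy y z with h' | rfl | h'
      · simp [h, h', h.not_gt, h'.not_gt, (h.trans h').not_gt]
      · simp [hd'']
      · rcases lt_trichotomy x z with h'' | rfl | h''
        · simp [h, h', h'', h.not_gt, h'.not_gt, h''.not_gt]
        · simp [hd']
        · simp [h, h', h'', h.not_gt, h'.not_gt, h''.not_gt]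
    · simp [hd]
    · rcases lt_trichotomy y z with h' | rfl | h'
      · rcases lt_trichotomy x z with h'' | rfl | h''
        · simp [h, h', h'', h.not_gt, h'.not_gt, h''.not_gt]
        · simp [hd']
        · simp [h, h', h'', h.not_gt, h'.not_gt, h''.not_gt]
      · simp [hd'']
      · simp [h, h', h.not_gt, h'.not_gt, (h'.trans h).not_gt]
  have rot : ∀ f : α → α → α → M, ∑ x, ∑ y, ∑ z, f y z x = ∑ x, ∑ y, ∑ z, f x y z := by
    intro f
    rw [Finset.sum_comm]
    exact Finset.sum_congr rfl fun x _ => Finset.sum_comm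
  have r₁ : (∑ x, ∑ y, ∑ z, if y < z ∧ z < x then u x y z else 0) =
      ∑ x, ∑ y, ∑ z, if x < y ∧ y < z then u x y z else 0 := by
    rw [← rot fun x y z => if x < y ∧ y < z then u x y z else 0]
    simp only [hu]
  have r₂ : (∑ x, ∑ y, ∑ z, if z < x ∧ x < y then u x y z else 0) =
      ∑ x, ∑ y, ∑ z, if x < y ∧ y < z then u x y z else 0 := by
    rw [← rot fun x y z => if z < x ∧ x < y then u x y z else 0]
    simp only [hu]
  have r₃ : (∑ x, ∑ y, ∑ z, if x < z ∧ z < y then u x y z else 0) =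
      ∑ x, ∑ y, ∑ z, if x < y ∧ y < z then u x z y else 0 :=
    Finset.sum_congr rfl fun x _ => Finset.sum_comm
  have r₄ : (∑ x, ∑ y, ∑ z, if z < y ∧ y < x then u x y z else 0) =
      ∑ x, ∑ y, ∑ z, if x < z ∧ z < y then u x y z else 0 := by
    rw [← rot fun x y z => if z < y ∧ y < x then u x y z else 0]
    simp only [hu]
  have r₅ : (∑ x, ∑ y, ∑ z, if y < x ∧ x < z then u x y z else 0) =
      ∑ x, ∑ y, ∑ z, if x < z ∧ z < y then u x y z else 0 := by
    rw [← rot fun x y z => if x < z ∧ z < y then u x y z else 0]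
    simp only [hu]
  have comb : ∀ x y z, (if x < y ∧ y < z then u x y z + u x z y else 0) =
      (if x < y ∧ y < z then u x y z else 0) + if x < y ∧ y < z then u x z y else 0 := by
    intros; split_ifs <;> simp
  have total := Finset.sum_congr rfl fun x (_ : x ∈ Finset.univ) => Finset.sum_congr rfl
    fun y (_ : y ∈ Finset.univ) => Finset.sum_congr rfl fun z (_ : z ∈ Finset.univ) => split x y z
  simp only [Finset.sum_add_distrib] at total
  simp only [comb, Finset.sum_add_distrib]
  rw [total, r₁, r₂, r₄, r₅, r₃]
  abel

variable [Fintype α]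

theorem two_mul_sum_cyclic {m : α → α → ℤ} (hm : ∀ i j, m i j = 0 ∨ m i j = 1) {s : α → ℤ}
    (hs : ∀ i, ∑ j, beats m i j = s i) :
    2 * ∑ x, ∑ y, ∑ z, beats m x y * beats m y z * beats m z x =
      ∑ i, (2 * ((Fintype.card α - 1 - s i) * s i) - s i ^ 2 + s i) := by
  have idem : ∀ x y, beats m x y * beats m x y = beats m x y := fun x y => by
    rcases beats_eq_zero_or_one hm x y with h | h <;> simp [h]
  have swap : ∀ x y, beats m x y = (if x = y then 0 else 1) - beats m y x := fun x y => by
    rw [← beats_add_beats m x y]; ring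
  have antisymm : ∀ x y, beats m x y * beats m y x = 0 := fun x y => by
    rw [swap y x]
    split_ifs with h
    · subst h; simp [beats_self]
    · rw [mul_sub, idem, mul_one, sub_self]
  have indeg : ∀ y, ∑ x, beats m x y = Fintype.card α - 1 - s y := fun y => by
    have : ∀ x, beats m x y = 1 - (if x = y then 1 else 0) - beats m y x := fun x => by
      rw [swap x y]; split_ifs <;> simp
    simp only [this, Finset.sum_sub_distrib, hs]
    simp
  have paths : ∑ x, ∑ y, ∑ z, beats m x y * beats m y z =
      ∑ i, (Fintype.card α - 1 - s i) * s i := by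
    simp only [← Finset.mul_sum, hs]
    rw [Finset.sum_comm]
    simp only [← Finset.sum_mul, indeg]
  have cyc : ∑ x, ∑ y, ∑ z, beats m x y * beats m y z * beats m z x =
      (∑ x, ∑ y, ∑ z, beats m x y * beats m y z)
        - ∑ x, ∑ y, ∑ z, beats m x y * beats m y z * beats m x z := by
    simp only [← Finset.sum_sub_distrib]
    refine Finset.sum_congr rfl fun x _ => Finset.sum_congr rfl fun y _ =>
      Finset.sum_congr rfl fun z _ => ?_
    rw [swap z x]
    split_ifs with h
    · subst h; rw [antisymm]; simp
    · ring
  have fork : ∑ i, s i ^ 2 = 2 * (∑ x, ∑ y, ∑ z, beats m x y * beats m y z * beats m x z)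
      + ∑ i, s i := by
    have pointwise : ∀ x y z, beats m x y * beats m x z = beats m x y * beats m y z * beats m x z
        + beats m x z * beats m z y * beats m x y + if y = z then beats m x y else 0 := by
      intro x y z
      rw [swap z y]
      rcases eq_or_ne y z with rfl | h
      · simp [beats_self, idem]
      · simp only [h, h.symm, if_false]; ring
    simp only [← hs, sq, Finset.sum_mul_sum]
    simp only [pointwise, Finset.sum_add_distrib]
    rw [two_mul]
    congr 1
    · congr 1
      exact Finset.sum_congr rfl fun x _ => Finset.sum_comm
    · simp
  simp only [Finset.sum_add_distrib, Finset.sum_sub_distrib, ← Finset.mul_sum]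
  rw [cyc, paths, fork]
  ring

theorem injective_of_sum_cyclic_eq_zero {m : α → α → ℤ} (hm : ∀ i j, m i j = 0 ∨ m i j = 1)
    {s : α → ℤ} (hs : ∀ i, ∑ j, beats m i j = s i)
    (h : ∑ x, ∑ y, ∑ z, beats m x y * beats m y z * beats m z x = 0) :
    Function.Injective s := by
  have nonneg : ∀ x y, 0 ≤ beats m x y := fun x y => by
    rcases beats_eq_zero_or_one hm x y with h | h <;> simp [h]
  have nonneg₃ : ∀ x y z, 0 ≤ beats m x y * beats m y z * beats m z x := fun x y z =>
    mul_nonneg (mul_nonneg (nonneg _ _) (nonneg _ _)) (nonneg _ _)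
  have acyclic : ∀ x y z, beats m x y * beats m y z * beats m z x = 0 := fun x y z => by
    have h₁ := (Finset.sum_eq_zero_iff_of_nonneg fun x _ => Finset.sum_nonneg fun y _ =>
      Finset.sum_nonneg fun z _ => nonneg₃ x y z).1 h x (Finset.mem_univ x)
    have h₂ := (Finset.sum_eq_zero_iff_of_nonneg fun y _ =>
      Finset.sum_nonneg fun z _ => nonneg₃ x y z).1 h₁ y (Finset.mem_univ y)
    exact (Finset.sum_eq_zero_iff_of_nonneg fun z _ => nonneg₃ x y z).1 h₂ z (Finset.mem_univ z)
  have lt_of_beats : ∀ i j, beats m i j = 1 → s j < s i := by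
    intro i j hij
    have hne : i ≠ j := by rintro rfl; simp [beats_self] at hij
    have hji : beats m j i = 0 := by
      have := beats_add_beats m i j
      rw [if_neg hne] at this
      omega
    rw [← hs, ← hs]
    refine Finset.sum_lt_sum (fun k _ => ?_) ⟨j, Finset.mem_univ j, by simp [beats_self, hij]⟩
    rcases beats_eq_zero_or_one hm j k with hjk | hjk
    · rw [hjk]; exact nonneg i k
    · have hki := acyclic i j k
      rw [hij, hjk, one_mul, one_mul] at hki
      have hik : i ≠ k := by rintro rfl; omega
      have := beats_add_beats m i k
      rw [if_neg hik] at this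
      omega
  intro i j hij
  by_contra hne
  have := beats_add_beats m i j
  rw [if_neg hne] at this
  rcases beats_eq_zero_or_one hm i j with h | h
  · exact (lt_of_beats j i (by omega)).ne hij
  · exact (lt_of_beats i j h).ne' hij

end Tournament

section Wedges

variable {n : ℕ}

theorem key_injective : Function.Injective (key : P n → ℕ) := by
  rintro ⟨⟨a, b⟩, hab⟩ ⟨⟨c, d⟩, hcd⟩ h
  simp only [key] at h
  have hac : a.1 = c.1 := by
    have := congrArg (· / n) h
    have hn : 0 < n := a.pos
    simpa [Nat.mul_comm _ n, Nat.mul_add_div hn, Nat.div_eq_of_lt] using this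
  have hbd : b.1 = d.1 := by rw [hac] at h; omega
  simp [Fin.ext hac, Fin.ext hbd]

/-- The free abelian group on all basis wedges, in all degrees. -/
abbrev V (n : ℕ) : Type := Finset (P n) →₀ ℤ

/-- The sign of moving `p` to its place in the sorted wedge `e_M`. -/
def sgn (M : Finset (P n)) (p : P n) : ℤ := (-1) ^ pos M p

/-- The change of `sgn M p` when `q` is added to `M`. -/
def eps (q p : P n) : ℤ := if key q < key p then -1 else 1

theorem eps_mul_self (q p : P n) : eps q p * eps q p = 1 := by
  unfold eps; split_ifs <;> simp

theorem eps_self (p : P n) : eps p p = 1 := by simp [eps]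

theorem eps_swap {p q : P n} (h : p ≠ q) : eps p q = -eps q p := by
  have : key p ≠ key q := fun H => h (key_injective H)
  unfold eps
  split_ifs <;> omega

theorem sgn_mul_self (M : Finset (P n)) (p : P n) : sgn M p * sgn M p = 1 := by
  simp [sgn, ← mul_pow]

theorem sgn_insert {M : Finset (P n)} {q : P n} (hq : q ∉ M) (p : P n) :
    sgn (insert q M) p = eps q p * sgn M p := by
  unfold sgn eps pos
  rw [Finset.filter_insert]
  split_ifs
  · rw [Finset.card_insert_of_notMem (by simp [hq]), pow_succ]; ring
  · simp

theorem sgn_erase {M : Finset (P n)} {q : P n} (hq : q ∈ M) (p : P n) :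
    sgn (M.erase q) p = eps q p * sgn M p := by
  conv_rhs => rw [← Finset.insert_erase hq, sgn_insert (Finset.notMem_erase q M),
    ← mul_assoc, eps_mul_self, one_mul]

/-- Exterior multiplication by `e_p`. -/
noncomputable def create (p : P n) : Module.End ℤ (V n) :=
  Finsupp.lsum ℤ fun M =>
    if p ∈ M then 0 else sgn M p • Finsupp.lsingle (insert p M)

/-- Contraction by `e_p`. -/
noncomputable def annihilate (p : P n) : Module.End ℤ (V n) :=
  Finsupp.lsum ℤ fun M =>
    if p ∈ M then sgn M p • Finsupp.lsingle (M.erase p) else 0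

theorem create_single (p : P n) (M : Finset (P n)) (r : ℤ) :
    create p (Finsupp.single M r) =
      if p ∈ M then 0 else Finsupp.single (insert p M) (sgn M p * r) := by
  rw [create, Finsupp.lsum_single]; split_ifs <;> simp [-Finsupp.single_mul]

theorem annihilate_single (p : P n) (M : Finset (P n)) (r : ℤ) :
    annihilate p (Finsupp.single M r) =
      if p ∈ M then Finsupp.single (M.erase p) (sgn M p * r) else 0 := by
  rw [annihilate, Finsupp.lsum_single]; split_ifs <;> simp

theorem create_create (p q : P n) : create p * create q = -(create q * create p) := by
  refine Finsupp.lhom_ext fun M r => ?_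
  simp only [Module.End.mul_apply, LinearMap.neg_apply, create_single]
  rcases eq_or_ne p q with rfl | hpq
  · split_ifs <;> simp [create_single, *, -Finsupp.single_mul]
  · by_cases hp : p ∈ M <;> by_cases hq : q ∈ M <;>
      simp [-Finsupp.single_mul, hp, hq, create_single, hpq, hpq.symm, sgn_insert]
    rw [Finset.insert_comm, ← Finsupp.single_neg, eps_swap hpq]
    congr 1; ring

theorem annihilate_annihilate (p q : P n) :
    annihilate p * annihilate q = -(annihilate q * annihilate p) := by
  refine Finsupp.lhom_ext fun M r => ?_
  simp only [Module.End.mul_apply, LinearMap.neg_apply, annihilate_single]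
  rcases eq_or_ne p q with rfl | hpq
  · split_ifs <;> simp [annihilate_single, *, -Finsupp.single_mul]
  · by_cases hp : p ∈ M <;> by_cases hq : q ∈ M <;>
      simp [-Finsupp.single_mul, hp, hq, annihilate_single, hpq, hpq.symm, sgn_erase]
    rw [Finset.erase_right_comm, ← Finsupp.single_neg, eps_swap hpq]
    congr 1; ring

theorem annihilate_create (p q : P n) : annihilate p * create q =
    (if p = q then 1 else 0 : ℤ) • 1 - create q * annihilate p := by
  refine Finsupp.lhom_ext fun M r => ?_
  simp only [Module.End.mul_apply, LinearMap.sub_apply, LinearMap.smul_apply, Module.End.one_apply,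
    annihilate_single, create_single]
  rcases eq_or_ne p q with rfl | hpq
  · by_cases hp : p ∈ M
    · simp [-Finsupp.single_mul, hp, create_single, sgn_erase, eps_self, ← mul_assoc, sgn_mul_self]
    · simp [-Finsupp.single_mul, hp, annihilate_single, sgn_insert, eps_self, ← mul_assoc,
        sgn_mul_self]
  · by_cases hp : p ∈ M <;> by_cases hq : q ∈ M <;>
      simp [-Finsupp.single_mul, hp, hq, annihilate_single, create_single, hpq, hpq.symm,
        sgn_erase, sgn_insert]
    rw [Finset.erase_insert_of_ne hpq.symm, ← Finsupp.single_neg, eps_swap hpq]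
    congr 1; ring

/-- `create` as a family indexed by all pairs of indices, zero unless `x < y`. -/
noncomputable def cr (x y : Fin n) : Module.End ℤ (V n) :=
  if h : x < y then create ⟨(x, y), h⟩ else 0

/-- `annihilate` as a family indexed by all pairs of indices, zero unless `x < y`. -/
noncomputable def an (x y : Fin n) : Module.End ℤ (V n) :=
  if h : x < y then annihilate ⟨(x, y), h⟩ else 0

theorem isCAR : IsCAR (cr : Fin n → Fin n → _) an where
  cc x y z w := by unfold cr; split_ifs <;> simp [create_create ⟨(x, y), _⟩]
  aa x y z w := by unfold an; split_ifs <;> simp [annihilate_annihilate ⟨(x, y), _⟩]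
  ac x y z w := by
    unfold an cr
    split_ifs <;> simp_all [annihilate_create] <;> omega
  c_zero x y h := dif_neg h
  a_zero x y h := dif_neg h

/-- Membership of `(x, y)` in `M` as an integer. -/
def ind (M : Finset (P n)) (x y : Fin n) : ℤ :=
  if h : x < y then if ⟨(x, y), h⟩ ∈ M then 1 else 0 else 0

theorem number_single (M : Finset (P n)) (r : ℤ) (x y : Fin n) :
    cr x y (an x y (Finsupp.single M r)) = ind M x y • Finsupp.single M r := by
  unfold cr an ind
  split_ifs with h h'
  · simp [-Finsupp.single_mul, h', annihilate_single, create_single, sgn_erase, eps_self,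
      ← mul_assoc, sgn_mul_self]
  · simp [-Finsupp.single_mul, h', annihilate_single]
  · simp

theorem ind_eq (M : Finset (P n)) (x y : Fin n) : ind M x y = 0 ∨ ind M x y = 1 := by
  unfold ind; split_ifs <;> simp

theorem sum_pairs {M : Type*} [AddCommMonoid M] (f : P n → M) :
    ∑ p, f p = ∑ x, ∑ y, if h : x < y then f ⟨(x, y), h⟩ else 0 := by
  rw [← Fintype.sum_prod_type' (f := fun x y : Fin n => if h : x < y then f ⟨(x, y), h⟩ else 0),
    ← Finset.sum_subset (Finset.subset_univ (Finset.univ.filter fun p : Fin n × Fin n => p.1 < p.2))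
      fun p _ hp => dif_neg (by simpa using hp),
    Finset.sum_subtype (p := fun p : Fin n × Fin n => p.1 < p.2) _ (by simp)]
  exact Finset.sum_congr rfl fun p _ => by rw [dif_pos p.2]

theorem sum_beats (M : Finset (P n)) (i : Fin n) : ∑ j, beats (ind M) i j = wt M i - 1 := by
  have card (q : P n → Prop) [DecidablePred q] : ((M.filter q).card : ℤ) =
      ∑ p, if q p then if p ∈ M then 1 else 0 else 0 := by
    simp only [← ite_and, Finset.sum_boole]
    congr 2
    ext p
    simp [and_comm]
  have out : ((M.filter fun p => p.1.1 = i).card : ℤ) = ∑ j, ind M i j := by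
    rw [card, sum_pairs, Finset.sum_eq_single i (fun x _ hx => by simp [hx]) (by simp)]
    simp [ind]
  have inn : ((M.filter fun p => p.1.2 = i).card : ℤ) = ∑ j, ind M j i := by
    rw [card, sum_pairs, Finset.sum_comm,
      Finset.sum_eq_single i (fun x _ hx => by simp [hx]) (by simp)]
    simp [ind]
  have low : ∑ j : Fin n, (if j < i then 1 else 0 : ℤ) = i := by
    simp [Finset.filter_gt_eq_Iio]
  have (j : Fin n) : beats (ind M) i j = ind M i j - ind M j i + if j < i then 1 else 0 := by
    unfold beats ind
    rcases lt_trichotomy i j with h | rfl | h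
    · simp [h, h.not_gt]
    · simp
    · simp only [h, h.not_gt, dite_true, if_true, if_false, dite_false]; ring
  simp only [this, Finset.sum_add_distrib, Finset.sum_sub_distrib, low, ← out, ← inn, wt]
  ring

/-- The Chevalley-Eilenberg boundary in all degrees at once. -/
noncomputable def boundary : Module.End ℤ (V n) := ∑ x, ∑ y, ∑ z, cr x z * an x y * an y z

/-- The adjoint of `boundary` for the basis of wedges. -/
noncomputable def coboundary : Module.End ℤ (V n) := ∑ x, ∑ y, ∑ z, cr y z * cr x y * an x z

/-- The combinatorial Laplacian. -/
noncomputable def laplacian : Module.End ℤ (V n) :=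
  boundary * coboundary + coboundary * boundary

/-- Six times the eigenvalue of the Laplacian on the wedges of modified weight `w`. -/
def eigenvalue (w : Fin n → ℤ) : ℤ :=
  ∑ i, (2 * ((n - 1 - (w i - 1)) * (w i - 1)) - (w i - 1) ^ 2 + (w i - 1))

theorem eigenvalue_wt (M : Finset (P n)) : eigenvalue (wt M) =
    2 * ∑ x, ∑ y, ∑ z, beats (ind M) x y * beats (ind M) y z * beats (ind M) z x := by
  rw [two_mul_sum_cyclic (ind_eq M) (sum_beats M), Fintype.card_fin, eigenvalue]

theorem laplacian_single (M : Finset (P n)) (r : ℤ) :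
    6 • laplacian (Finsupp.single M r) =
      eigenvalue (wt M) • Finsupp.single M r := by
  rw [eigenvalue_wt, sum_cyclic (fun x y z => by ring) (fun x z => by simp [beats_self]),
    laplacian, boundary, coboundary, isCAR.laplacian]
  have (x y z : Fin n) : (if x < y ∧ y < z then
      cr x z * an x z + cr x y * an x y * (cr y z * an y z) - cr x z * an x z * (cr y z * an y z)
        - cr x y * an x y * (cr x z * an x z) else 0) (Finsupp.single M r) =
      (if x < y ∧ y < z then beats (ind M) x y * beats (ind M) y z * beats (ind M) z x
        + beats (ind M) x z * beats (ind M) z y * beats (ind M) y x else 0) •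
          Finsupp.single M r := by
    split_ifs with h
    · simp only [LinearMap.add_apply, LinearMap.sub_apply, Module.End.mul_apply, number_single,
        map_zsmul, smul_smul, ← add_smul, ← sub_smul]
      congr 1
      simp only [beats, h.1, h.2, h.1.trans h.2, h.1.not_gt, h.2.not_gt, (h.1.trans h.2).not_gt,
        if_true, if_false]
      ring
    · simp
  simp only [LinearMap.sum_apply, this, ← Finset.sum_smul]
  simp only [← Nat.cast_smul_eq_nsmul ℤ, smul_smul]
  norm_num [← mul_assoc]

/-- The span of the wedges of degree `k` and modified weight `w`. -/
def graded (k : ℤ) (w : Fin n → ℤ) : Submodule ℤ (V n) :=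
  Finsupp.supported ℤ ℤ {M | (M.card : ℤ) = k ∧ wt M = w}

theorem single_mem_graded (M : Finset (P n)) (r : ℤ) :
    Finsupp.single M r ∈ graded (M.card : ℤ) (wt M) :=
  Finsupp.single_mem_supported ℤ r ⟨rfl, rfl⟩

theorem laplacian_of_mem_graded {k : ℤ} {w : Fin n → ℤ} {v : V n} (hv : v ∈ graded k w) :
    6 • laplacian v = eigenvalue w • v := by
  rw [graded, Finsupp.supported_eq_span_single] at hv
  induction hv using Submodule.span_induction with
  | mem v hv =>
    obtain ⟨M, hM, rfl⟩ := hv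
    rw [laplacian_single, hM.2]
  | zero => simp
  | add u v _ _ hu hv => rw [map_add, smul_add, hu, hv, smul_add]
  | smul r v _ hv => rw [map_smul, smul_comm, hv, smul_comm]

theorem map_mem_graded {f : Module.End ℤ (V n)} {k l : ℤ} {w w' : Fin n → ℤ}
    (h : ∀ M : Finset (P n), (M.card : ℤ) = k → wt M = w → f (Finsupp.single M 1) ∈ graded l w')
    {v : V n} (hv : v ∈ graded k w) : f v ∈ graded l w' := by
  rw [graded, Finsupp.supported_eq_span_single] at hv
  refine Submodule.span_le (p := (graded l w').comap f) |>.2 ?_ hv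
  rintro _ ⟨M, hM, rfl⟩
  exact h M hM.1 hM.2

theorem wt_insert {M : Finset (P n)} {p : P n} (hp : p ∉ M) :
    wt (insert p M) = wt M + (Pi.single p.1.1 1 - Pi.single p.1.2 1) := by
  ext i
  simp only [wt, Finset.filter_insert, Pi.add_apply, Pi.sub_apply, Pi.single_apply,
    eq_comm (a := i)]
  split_ifs <;> simp [hp] <;> ring

theorem cr_mem_graded {k : ℤ} {w : Fin n → ℤ} {v : V n} (x y : Fin n) (hv : v ∈ graded k w) :
    cr x y v ∈ graded (k + 1) (w + (Pi.single x 1 - Pi.single y 1)) := by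
  refine map_mem_graded (fun M hk hM => ?_) hv
  subst hk hM
  unfold cr
  split_ifs with h
  · rw [create_single]
    split_ifs with hM
    · exact zero_mem _
    · convert single_mem_graded _ _ using 1
      rw [wt_insert hM, Finset.card_insert_of_notMem hM, Nat.cast_succ]
  · exact zero_mem _

theorem an_mem_graded {k : ℤ} {w : Fin n → ℤ} {v : V n} (x y : Fin n) (hv : v ∈ graded k w) :
    an x y v ∈ graded (k - 1) (w - (Pi.single x 1 - Pi.single y 1)) := by
  refine map_mem_graded (fun M hk hM => ?_) hv
  subst hk hM
  unfold an
  split_ifs with h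
  · rw [annihilate_single]
    split_ifs with hM
    · convert single_mem_graded _ _ using 1
      conv_lhs => rw [← Finset.insert_erase hM]
      rw [wt_insert (Finset.notMem_erase _ _),
        Finset.card_insert_of_notMem (Finset.notMem_erase _ _), Nat.cast_succ,
        add_sub_cancel_right, add_sub_cancel_right]
    · exact zero_mem _
  · exact zero_mem _

theorem boundary_mem_graded {k : ℤ} {w : Fin n → ℤ} {v : V n} (hv : v ∈ graded k w) :
    boundary v ∈ graded (k - 1) w := by
  simp only [boundary, LinearMap.sum_apply, Module.End.mul_apply]
  refine sum_mem fun x _ => sum_mem fun y _ => sum_mem fun z _ => ?_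
  convert cr_mem_graded x z (an_mem_graded x y (an_mem_graded y z hv)) using 2
  · ring
  · abel

theorem coboundary_mem_graded {k : ℤ} {w : Fin n → ℤ} {v : V n} (hv : v ∈ graded k w) :
    coboundary v ∈ graded (k + 1) w := by
  simp only [coboundary, LinearMap.sum_apply, Module.End.mul_apply]
  refine sum_mem fun x _ => sum_mem fun y _ => sum_mem fun z _ => ?_
  convert cr_mem_graded y z (cr_mem_graded x y (an_mem_graded x z hv)) using 2
  · ring
  · abel

theorem eigenvalue_wt_ne_zero {M : Finset (P n)} (hM : ∀ i, 1 ≤ wt M i ∧ wt M i ≤ n)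
    (h : ¬ ∃ π : Equiv.Perm (Fin n), wt M = permWt n π) : eigenvalue (wt M) ≠ 0 := by
  intro h0
  rw [eigenvalue_wt, mul_eq_zero, or_iff_right two_ne_zero] at h0
  have inj := injective_of_sum_cyclic_eq_zero (ind_eq M) (sum_beats M) h0
  let f (i : Fin n) : Fin n := ⟨(wt M i - 1).toNat, by have := hM i; omega⟩
  have hf (i : Fin n) : ((f i : ℕ) : ℤ) = wt M i - 1 := Int.toNat_of_nonneg (by linarith [hM i])
  have f_inj : Function.Injective f := fun i j hij => inj (by simp only [← hf, hij])
  exact h ⟨Equiv.ofBijective f (Finite.injective_iff_bijective.1 f_inj),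
    funext fun i => by simp [permWt, hf]⟩

theorem boundary_apply (v : V n) : boundary v = ∑ a : P n, ∑ b : P n,
    if hab : a.1.2 = b.1.1 then
      create ⟨(a.1.1, b.1.2), a.2.trans (hab ▸ b.2)⟩ (annihilate a (annihilate b v)) else 0 := by
  simp only [boundary, LinearMap.sum_apply, Module.End.mul_apply]
  rw [sum_pairs]
  refine Finset.sum_congr rfl fun x _ => Finset.sum_congr rfl fun y _ => ?_
  split_ifs with hxy
  · rw [sum_pairs]
    refine .trans ?_ (Finset.sum_eq_single y (fun z _ hz => by simp [hz.symm]) (by simp)).symm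
    refine Finset.sum_congr rfl fun z _ => ?_
    by_cases hyz : y < z
    · simp [cr, an, hxy, hyz, hxy.trans hyz]
    · simp [an, hyz]
  · simp [an, hxy]

theorem eps_of_composable {a b : P n} (hab : a.1.2 = b.1.1) : eps b a = 1 := by
  have : key a < key b := by
    obtain ⟨⟨x, y⟩, h⟩ := a
    obtain ⟨⟨y', z⟩, h'⟩ := b
    obtain rfl : y = y' := hab
    have := Nat.mul_le_mul_right n (Nat.succ_le_of_lt (show x.1 < y.1 from h))
    simp only [key]
    linarith [y.2, Nat.succ_mul x.1 n]
  rw [eps, if_neg this.not_gt]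

/-- Chains of degree `k` as chains of arbitrary degree. -/
noncomputable def ofC (k : ℤ) : C n k →ₗ[ℤ] V n := Finsupp.lmapDomain ℤ ℤ Subtype.val

theorem ofC_dAux {k : ℤ} {M : Finset (P n)} (hM : (M.card : ℤ) = k + 1) :
    ofC k (dAux k M) = boundary (Finsupp.single M 1) := by
  rw [dAux, boundary_apply, map_sum]
  refine Finset.sum_subset_zero_on_sdiff (Finset.subset_univ M) (fun a ha => ?_) fun a ha => ?_
  · refine Finset.sum_eq_zero fun b _ => ?_
    have : a ∉ M := by simpa using ha
    rw [annihilate_single]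
    split_ifs <;> simp [annihilate_single, this]
  rw [map_sum]
  refine Finset.sum_subset_zero_on_sdiff (Finset.subset_univ M) (fun b hb => ?_) fun b hb => ?_
  · have : b ∉ M := by simpa using hb
    simp [annihilate_single, this]
  split_ifs with hab
  · have hne : a ≠ b := by
      rintro rfl
      exact a.2.ne hab.symm
    have haM : a ∈ M.erase b := Finset.mem_erase.2 ⟨hne, ha⟩
    have hcard : (((M.erase b).erase a).card : ℤ) = k - 1 := by
      have h₁ := Finset.card_erase_add_one hb
      have h₂ := Finset.card_erase_add_one haM
      omega
    rw [annihilate_single, if_pos hb, annihilate_single, if_pos haM, create_single,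
      sgn_erase hb, eps_of_composable hab, Finset.erase_right_comm]
    dsimp only
    split_ifs with hk hc hc
    · rw [Finset.insert_eq_of_mem hc] at hk
      omega
    · rw [map_smul, ofC, Finsupp.lmapDomain_apply, Finsupp.mapDomain_single, Finsupp.smul_single]
      congr 1
      rw [pow_add, pow_add]
      simp only [← sgn.eq_1, sgn_insert hc, eps_self, smul_eq_mul]
      ring
    · simp
    · rw [Finset.card_insert_of_notMem hc] at hk
      push_cast at hk
      omega
  · simp

/-- Chains of degree `k` and weight `w` as chains of arbitrary degree and weight. -/
noncomputable def ofCw (k : ℤ) (w : Fin n → ℤ) : Cw n k w →ₗ[ℤ] V n :=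
  Finsupp.lmapDomain ℤ ℤ Subtype.val

theorem ofCw_single {k : ℤ} {w : Fin n → ℤ} (M : Bw n k w) (r : ℤ) :
    ofCw k w (Finsupp.single M r) = Finsupp.single M.1 r :=
  Finsupp.mapDomain_single

theorem ofCw_injective (k : ℤ) (w : Fin n → ℤ) : Function.Injective (ofCw k w) :=
  Finsupp.mapDomain_injective Subtype.val_injective

theorem range_ofCw (k : ℤ) (w : Fin n → ℤ) : LinearMap.range (ofCw k w) = graded k w := by
  rw [ofCw, graded, LinearMap.range_eq_map, ← Finsupp.supported_univ, Finsupp.lmapDomain_supported,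
    Set.image_univ]
  exact congrArg _ Subtype.range_val

theorem ofCw_projW {k : ℤ} {w : Fin n → ℤ} (v : C n k) :
    ofCw k w (projW n k w v) = Finsupp.filter (fun M => wt M = w) (ofC k v) := by
  induction v using Finsupp.induction_linear with
  | zero => simp [Finsupp.filter_zero]
  | add u v hu hv => rw [map_add, map_add, map_add, hu, hv, Finsupp.filter_add]
  | single M r =>
    rw [projW, Finsupp.lsum_single, ofC, Finsupp.lmapDomain_apply, Finsupp.mapDomain_single]
    split_ifs with h
    · rw [LinearMap.toSpanSingleton_apply, map_smul, ofCw_single, Finsupp.smul_single_one,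
        Finsupp.filter_single_of_pos (fun M => wt M = w) h]
    · rw [LinearMap.zero_apply, map_zero, Finsupp.filter_single_of_neg (fun M => wt M = w) h]

theorem ofCw_dW {k : ℤ} {w : Fin n → ℤ} (v : Cw n (k + 1) w) :
    ofCw k w (dW n k w v) = boundary (ofCw (k + 1) w v) := by
  induction v using Finsupp.induction_linear with
  | zero => simp
  | add u v hu hv => rw [map_add, map_add, map_add, hu, hv, map_add]
  | single M r =>
    have mem : boundary (Finsupp.single M.1 1) ∈ graded k w := by
      have := boundary_mem_graded (single_mem_graded M.1 1)
      rwa [M.2.1, M.2.2, add_sub_cancel_right] at this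
    rw [dW, LinearMap.comp_apply, LinearMap.comp_apply, ofCw_projW, inclW,
      Finsupp.lmapDomain_apply, Finsupp.mapDomain_single, d, Finsupp.lsum_single,
      LinearMap.toSpanSingleton_apply, map_smul, ofC_dAux M.2.1, ofCw_single,
      Finsupp.filter_smul, (Finsupp.filter_eq_self_iff _ _).2, ← map_smul, Finsupp.smul_single_one]
    intro M' hM'
    exact (mem (Finsupp.mem_support_iff.2 hM')).2

theorem ofCw_castCw {k l : ℤ} (w : Fin n → ℤ) (h : k = l) (v : Cw n k w) :
    ofCw l w (castCw n w h v) = ofCw k w v := by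
  induction v using Finsupp.induction_linear with
  | zero => simp
  | add u v hu hv => rw [map_add, map_add, map_add, hu, hv]
  | single M r =>
    rw [castCw, Finsupp.domLCongr_single, ofCw_single, ofCw_single]
    rfl

theorem boundary_ofCw_of_mem_ZW {k : ℤ} {w : Fin n → ℤ} {v : Cw n k w} (hv : v ∈ ZW n k w) :
    boundary (ofCw k w v) = 0 := by
  rw [ZW, LinearMap.mem_ker, dFromW, LinearMap.comp_apply] at hv
  rw [← ofCw_castCw w (by ring : k = k - 1 + 1), ← ofCw_dW]
  exact (congrArg _ hv).trans (map_zero _)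

theorem eigenvalue_smul_mem_range_dW {k : ℤ} {w : Fin n → ℤ} {v : Cw n k w}
    (hv : v ∈ ZW n k w) : eigenvalue w • v ∈ LinearMap.range (dW n k w) := by
  have mem : ofCw k w v ∈ graded k w := range_ofCw k w ▸ LinearMap.mem_range_self _ v
  have lap := laplacian_of_mem_graded mem
  rw [laplacian, LinearMap.add_apply, Module.End.mul_apply, Module.End.mul_apply,
    boundary_ofCw_of_mem_ZW hv, map_zero, add_zero] at lap
  obtain ⟨u, hu⟩ := LinearMap.mem_range.1 (range_ofCw (k + 1) w ▸ coboundary_mem_graded mem)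
  refine ⟨6 • u, ofCw_injective k w ?_⟩
  rw [map_nsmul, map_nsmul, ofCw_dW, hu, lap, map_smul]

end Wedges

/-- Lemma 4.2: for `w ∈ 𝒯_n = 𝒮_n ∖ {permutations of (1,…,n)}`, the homology of `⟦w⟧`
consists entirely of torsion. -/
theorem nonperm_weight_torsion (n : ℕ) (w : Fin n → ℤ) (hw : Sn n w)
    (hnp : ¬ ∃ π : Equiv.Perm (Fin n), w = permWt n π) :
    ∀ (k : ℤ) (x : Hw n k w), ∃ c : ℤ, c ≠ 0 ∧ c • x = 0 := by
  intro k x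
  obtain ⟨v, rfl⟩ := Submodule.Quotient.mk_surjective (HwSub n k w) x
  by_cases hM : ∃ M : Finset (P n), wt M = w
  · obtain ⟨M, rfl⟩ := hM
    refine ⟨eigenvalue (wt M), eigenvalue_wt_ne_zero hw.1 hnp, ?_⟩
    exact (Submodule.Quotient.mk_eq_zero (HwSub n k (wt M)) (x := eigenvalue (wt M) • v)).2
      ⟨eigenvalue_smul_mem_range_dW v.2, (eigenvalue (wt M) • v).2⟩
  · have : IsEmpty (Bw n k w) := ⟨fun M => hM ⟨M.1, M.2.2⟩⟩
    refine ⟨1, one_ne_zero, ?_⟩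
    rw [Subsingleton.elim v 0]
    exact (one_smul ℤ _).trans (Submodule.Quotient.mk_zero (HwSub n k w))

end Nil
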